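/- Let 1 ≤ p ≤ n−1 and let α ∈ A²_{(p,0)}(ℂⁿ, e^{-|z|²}) with ∂α = 0. Then u₀ = ∂*Ñ_p α satisfies ∂u₀ = α, u₀ is orthogonal to ker ∂ (equivalently u₀ ∈ im ∂*), and ‖∂*Ñ_p α‖ ≤ p^{-1/2} ‖α‖. -/

import Mathlib

open MeasureTheory Filter Complex Finset

noncomputable section

/-- Points of `ℂⁿ`. -/
abbrev Cn (n : ℕ) := Fin n → ℂ

/-- A form with coefficients indexed by subsets of `{1,…,n}`; a `(p,0)`-form
`Σ'_{|J|=p} u_J dz_J` is such a family supported on sets of cardinality `p`. -/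
abbrev FormC (n : ℕ) := Finset (Fin n) → Cn n → ℂ

/-- The Fock weight `e^{-|z|²}` on `ℂⁿ`. -/
def fWt {n : ℕ} (z : Cn n) : ℝ := Real.exp (-(∑ j, ‖z j‖ ^ 2))

/-- Squared Fock norm `‖f‖² = ∫ |f|² e^{-|z|²} dλ`. -/
def fNormSq {n : ℕ} (f : Cn n → ℂ) : ℝ := ∫ z : Cn n, ‖f z‖ ^ 2 * fWt z

/-- Fock inner product `(f,g) = ∫ f ḡ e^{-|z|²} dλ`. -/
def fInner {n : ℕ} (f g : Cn n → ℂ) : ℂ :=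
  ∫ z : Cn n, f z * (starRingEnd ℂ) (g z) * fWt z

/-- Membership in the Fock space `A²(ℂⁿ, e^{-|z|²})`. -/
def MemF {n : ℕ} (f : Cn n → ℂ) : Prop :=
  Differentiable ℂ f ∧ Integrable (fun z : Cn n => ‖f z‖ ^ 2 * fWt z)

/-- The holomorphic partial derivative `∂f/∂z_j`. -/
def pdz {n : ℕ} (j : Fin n) (f : Cn n → ℂ) : Cn n → ℂ :=
  fun z => fderiv ℂ f z (Pi.single j 1)

/-- The sign `(-1)^{#{i ∈ J : i < j}}` arising from `dz_j ∧ dz_J`. -/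
def sgn {n : ℕ} (j : Fin n) (J : Finset (Fin n)) : ℂ :=
  (-1 : ℂ) ^ (J.filter (fun i => i < j)).card

/-- The operator `∂`: `(∂u)_L = Σ_{j ∈ L} ± ∂u_{L\{j}}/∂z_j`, i.e.
`∂u = Σ'_J Σ_j (∂u_J/∂z_j) dz_j ∧ dz_J`. -/
def dOp {n : ℕ} (u : FormC n) : FormC n :=
  fun L z => ∑ j ∈ L, sgn j (L.erase j) * pdz j (u (L.erase j)) z

/-- The adjoint `∂*`: `(∂*u)_K = Σ_{j ∉ K} ± z_j u_{K ∪ {j}}`, i.e.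
`∂*u = Σ'_K Σ_j z_j u_{jK} dz_K` on the Fock space. -/
def dStarOp {n : ℕ} (u : FormC n) : FormC n :=
  fun K z => ∑ j ∈ Kᶜ, sgn j K * (z j * u (insert j K) z)

/-- The complex Laplacian `□̃ = ∂*∂ + ∂∂*`. -/
def boxOp {n : ℕ} (u : FormC n) : FormC n :=
  fun J z => dStarOp (dOp u) J z + dOp (dStarOp u) J z

/-- All coefficients belong to the Fock space. -/
def MemA2 {n : ℕ} (u : FormC n) : Prop := ∀ J, MemF (u J)

/-- `u` is a `(p,0)`-form: only coefficients with `|J| = p` may be nonzero. -/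
def IsDeg {n : ℕ} (p : ℕ) (u : FormC n) : Prop :=
  ∀ J : Finset (Fin n), J.card ≠ p → u J = 0

/-- Squared norm of a form: `Σ'_J ‖u_J‖²`. -/
def formNormSq {n : ℕ} (u : FormC n) : ℝ := ∑ J : Finset (Fin n), fNormSq (u J)

/-- Inner product of forms: `Σ'_J (u_J, v_J)`. -/
def formInner {n : ℕ} (u v : FormC n) : ℂ := ∑ J : Finset (Fin n), fInner (u J) (v J)

/-- `u ∈ dom ∂`. -/
def domD {n : ℕ} (u : FormC n) : Prop := MemA2 u ∧ MemA2 (dOp u)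

/-- `u ∈ dom ∂*`. -/
def domDs {n : ℕ} (u : FormC n) : Prop := MemA2 u ∧ MemA2 (dStarOp u)

/-- `u ∈ dom □̃`: `u ∈ dom ∂ ∩ dom ∂*`, `∂u ∈ dom ∂*` and `∂*u ∈ dom ∂`. -/
def domBox {n : ℕ} (u : FormC n) : Prop :=
  domD u ∧ domDs u ∧ domDs (dOp u) ∧ domD (dStarOp u)

/-- `N` is the bounded inverse `Ñ_p` of `□̃_p` on `A²_{(p,0)}(ℂⁿ, e^{-|z|²})`:
for `v ∈ A²_{(p,0)}`, `N v` is the unique element of `dom □̃_p` with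
`□̃_p (N v) = v`. -/
def IsInvBox {n : ℕ} (p : ℕ) (N : FormC n → FormC n) : Prop :=
  ∀ v : FormC n, IsDeg p v → MemA2 v →
    (IsDeg p (N v) ∧ domBox (N v) ∧ boxOp (N v) = v) ∧
    (∀ u : FormC n, IsDeg p u → domBox u → boxOp u = v → N v = u)

lemma sum_single_eq {n : ℕ} (v : Cn n) : v = ∑ j, v j • (Pi.single j (1 : ℂ) : Cn n) := by
  ext i
  simp [Finset.sum_apply, Pi.single_apply]

/-- Cauchy's formula for a partial derivative, over the unit circle in the `j`-th variable. -/
lemma pdz_eq_circle {n : ℕ} {f : Cn n → ℂ} (hf : Differentiable ℂ f) (j : Fin n) (z : Cn n) :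
    pdz j f z = (2 * Real.pi : ℂ)⁻¹ * ∫ θ in Set.Ioc 0 (2 * Real.pi),
      exp (-(θ * I)) * f (z + Pi.single j (exp (θ * I))) := by
  have hline : ∀ ζ : ℂ, HasDerivAt (fun ζ : ℂ => z + Pi.single j ζ) (Pi.single j 1) ζ := by
    intro ζ
    rw [hasDerivAt_pi]
    intro i
    by_cases h : i = j
    · subst h; simpa using (hasDerivAt_id ζ).const_add (z i)
    · simpa [h] using hasDerivAt_const ζ (z i)
  have hg : ∀ ζ : ℂ, HasDerivAt (fun ζ : ℂ => f (z + Pi.single j ζ))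
      (fderiv ℂ f (z + Pi.single j ζ) (Pi.single j 1)) ζ := fun ζ =>
    (hf _).hasFDerivAt.comp_hasDerivAt ζ (hline ζ)
  have hd : Differentiable ℂ (fun ζ : ℂ => f (z + Pi.single j ζ)) :=
    fun ζ => (hg ζ).differentiableAt
  have key := (hd.differentiableOn (s := Metric.closedBall 0 1)).deriv_eq_smul_circleIntegral
    one_pos
  rw [(hg 0).deriv] at key
  simp only [Pi.single_zero, add_zero] at key
  rw [circleIntegral, intervalIntegral.integral_of_le (by positivity)] at key
  have e : ∀ θ : ℝ, deriv (circleMap 0 1) θ • ((1 / (circleMap 0 1 θ - 0) ^ 2) •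
      f (z + Pi.single j (circleMap 0 1 θ))) =
      I * (exp (-(θ * I)) * f (z + Pi.single j (exp (θ * I)))) := by
    intro θ
    have h0 : exp (θ * I) ≠ 0 := exp_ne_zero _
    simp only [deriv_circleMap, circleMap, smul_eq_mul, exp_neg, ofReal_one, one_mul, zero_add,
      sub_zero]
    field_simp
  simp_rw [e] at key
  rw [integral_const_mul, smul_eq_mul] at key
  have hpi : (Real.pi : ℂ) ≠ 0 := by exact_mod_cast Real.pi_ne_zero
  change fderiv ℂ f z (Pi.single j 1) = _
  have h2 := mul_left_cancel₀ I_ne_zero (key.trans (by ring :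
    (2 * Real.pi * I) * fderiv ℂ f z (Pi.single j 1) =
      I * (2 * Real.pi * fderiv ℂ f z (Pi.single j 1))))
  rw [h2]
  field_simp

lemma exists_norm_fderiv_le {n : ℕ} {f : Cn n → ℂ} (hf : Differentiable ℂ f) (R : ℝ) :
    ∃ M, ∀ z : Cn n, ‖z‖ ≤ R → ‖fderiv ℂ f z‖ ≤ M := by
  obtain ⟨M, hM⟩ := (isCompact_closedBall (0 : Cn n) (R + 1)).exists_bound_of_continuousOn
    hf.continuous.continuousOn
  refine ⟨(2 * M) / 1, fun z hz => ?_⟩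
  refine Complex.norm_fderiv_le_div_of_mapsTo_ball (R₁ := 1) hf.differentiableOn ?_ one_pos
  intro y hy
  rw [mem_ball_iff_norm] at hy
  have hy' : ‖y‖ ≤ R + 1 := by
    calc ‖y‖ = ‖z + (y - z)‖ := by congr 1; abel
      _ ≤ ‖z‖ + ‖y - z‖ := norm_add_le _ _
      _ ≤ R + 1 := by linarith
  have h1 := hM y (by simpa using hy')
  have h2 := hM z (by simpa using hz.trans (by linarith))
  rw [mem_closedBall_iff_norm]
  have := norm_sub_le (f y) (f z)
  linarith

/-- Averages of translates of an entire function along a curve are entire. -/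
lemma differentiable_integral_translates {n : ℕ} {f : Cn n → ℂ} (hf : Differentiable ℂ f)
    {c : ℝ → ℂ} {γ : ℝ → Cn n} (hc : Continuous c) (hγ : Continuous γ) (hc1 : ∀ θ, ‖c θ‖ ≤ 1)
    (hγ1 : ∀ θ, ‖γ θ‖ ≤ 1) (a b : ℝ) :
    Differentiable ℂ fun z => ∫ θ in Set.Ioc a b, c θ * f (z + γ θ) := by
  intro z₀
  have hF : ∀ z : Cn n, Continuous fun θ : ℝ => c θ * f (z + γ θ) := fun z =>
    hc.mul (hf.continuous.comp (continuous_const.add hγ))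
  obtain ⟨M, hM⟩ := exists_norm_fderiv_le hf (‖z₀‖ + 2)
  have hF' : AEStronglyMeasurable (fun θ : ℝ => c θ • fderiv ℂ f (z₀ + γ θ))
      (volume.restrict (Set.Ioc a b)) :=
    hc.aestronglyMeasurable.smul ((measurable_fderiv ℂ f).comp
      (continuous_const.add hγ).measurable).aestronglyMeasurable
  have hbound : ∀ θ : ℝ, ∀ z ∈ Metric.ball z₀ 1, ‖c θ • fderiv ℂ f (z + γ θ)‖ ≤ M := by
    intro θ z hz
    rw [mem_ball_iff_norm] at hz
    have h1 : ‖z + γ θ‖ ≤ ‖z₀‖ + 2 := by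
      calc ‖z + γ θ‖ = ‖z₀ + (z - z₀) + γ θ‖ := by congr 2; abel
        _ ≤ ‖z₀‖ + ‖z - z₀‖ + ‖γ θ‖ := norm_add₃_le
        _ ≤ ‖z₀‖ + 2 := by linarith [hγ1 θ]
    rw [norm_smul]
    exact (mul_le_of_le_one_left (norm_nonneg _) (hc1 θ)).trans (hM _ h1)
  have hdiff : ∀ θ : ℝ, ∀ z ∈ Metric.ball z₀ 1,
      HasFDerivAt (fun z : Cn n => c θ * f (z + γ θ)) (c θ • fderiv ℂ f (z + γ θ)) z :=
    fun θ z _ => ((hasFDerivAt_comp_add_right (γ θ)).2 (hf _).hasFDerivAt).const_mul _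
  exact (hasFDerivAt_integral_of_dominated_of_fderiv_le (𝕜 := ℂ)
    (bound := fun _ => M) (Metric.ball_mem_nhds z₀ one_pos)
    (Eventually.of_forall fun z => (hF z).aestronglyMeasurable)
    ((hF z₀).integrableOn_Ioc) hF' (Eventually.of_forall hbound) (integrable_const _)
    (Eventually.of_forall hdiff)).differentiableAt

/-- The partial derivatives of an entire function are entire. -/
lemma differentiable_pdz {n : ℕ} {f : Cn n → ℂ} (hf : Differentiable ℂ f) (j : Fin n) :
    Differentiable ℂ (pdz j f) := by
  have heq : pdz j f = fun z => (2 * Real.pi : ℂ)⁻¹ * ∫ θ in Set.Ioc 0 (2 * Real.pi),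
      exp (-(θ * I)) * f (z + Pi.single j (exp (θ * I))) := funext (pdz_eq_circle hf j)
  rw [heq]
  refine (differentiable_integral_translates hf (c := fun θ : ℝ => exp (-(θ * I)))
    (γ := fun θ : ℝ => Pi.single j (exp (θ * I))) (by fun_prop)
    ((continuous_single j).comp (by fun_prop)) (fun θ => ?_) (fun θ => ?_) _ _).const_mul _
  · simp [norm_exp]
  · rw [Pi.norm_single, norm_exp_ofReal_mul_I]

lemma differentiable_fderiv {n : ℕ} {f : Cn n → ℂ} (hf : Differentiable ℂ f) :
    Differentiable ℂ (fderiv ℂ f) := by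
  have : fderiv ℂ f = fun z => ∑ j, (pdz j f z) •
      (ContinuousLinearMap.proj j : Cn n →L[ℂ] ℂ) := by
    ext z v
    conv_lhs => rw [sum_single_eq v]
    simp [pdz, mul_comm]
  rw [this]
  exact Differentiable.fun_sum fun j _ => (differentiable_pdz hf j).smul_const _

lemma pdz_comm {n : ℕ} {f : Cn n → ℂ} (hf : Differentiable ℂ f) (i j : Fin n) (z : Cn n) :
    pdz i (pdz j f) z = pdz j (pdz i f) z := by
  have h := second_derivative_symmetric (fun y => (hf y).hasFDerivAt)
    (differentiable_fderiv hf z).hasFDerivAt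
  have e : ∀ k l : Fin n, pdz k (pdz l f) z =
      fderiv ℂ (fderiv ℂ f) z (Pi.single k 1) (Pi.single l 1) := by
    intro k l
    have h1 := ((differentiable_fderiv hf z).hasFDerivAt.clm_apply
      (hasFDerivAt_const (Pi.single l (1 : ℂ) : Cn n) z)).fderiv
    change fderiv ℂ (fun y => fderiv ℂ f y (Pi.single l 1)) z (Pi.single k 1) = _
    rw [h1]
    simp
  rw [e, e, h]

lemma sgn_insert {n : ℕ} {i : Fin n} {K : Finset (Fin n)} (hi : i ∉ K) (j : Fin n) :
    sgn j (insert i K) = sgn j K * if i < j then -1 else 1 := by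
  unfold sgn
  rw [Finset.filter_insert]
  split_ifs with h
  · rw [Finset.card_insert_of_notMem (by simp [hi]), pow_succ]
  · rw [mul_one]

lemma sgn_swap {n : ℕ} {i j : Fin n} {K : Finset (Fin n)} (hij : i ≠ j) (hi : i ∉ K)
    (hj : j ∉ K) :
    sgn j (insert i K) * sgn i K = -(sgn i (insert j K) * sgn j K) := by
  rw [sgn_insert hi, sgn_insert hj]
  rcases lt_or_gt_of_ne hij with h | h
  · simp [h, h.not_gt]; ring
  · simp [h, h.not_gt]; ring

lemma sgn_mul_self {n : ℕ} (j : Fin n) (J : Finset (Fin n)) : sgn j J * sgn j J = 1 := by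
  unfold sgn
  rw [← mul_pow]; simp

lemma pdz_sum_mul {n : ℕ} {ι : Type*} (s : Finset ι) (c : ι → ℂ) (F : ι → Cn n → ℂ)
    (hF : ∀ i ∈ s, Differentiable ℂ (F i)) (j : Fin n) (z : Cn n) :
    pdz j (fun z => ∑ i ∈ s, c i * F i z) z = ∑ i ∈ s, c i * pdz j (F i) z := by
  have h : HasFDerivAt (fun z => ∑ i ∈ s, c i * F i z) (∑ i ∈ s, c i • fderiv ℂ (F i) z) z :=
    HasFDerivAt.fun_sum fun i hi => ((hF i hi) z).hasFDerivAt.const_mul _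
  simp [pdz, h.fderiv]

lemma pdz_sub {n : ℕ} {f g : Cn n → ℂ} (hf : Differentiable ℂ f) (hg : Differentiable ℂ g)
    (j : Fin n) (z : Cn n) : pdz j (fun z => f z - g z) z = pdz j f z - pdz j g z := by
  simp [pdz, fderiv_fun_sub (hf z) (hg z)]

lemma pdz_coord_mul {n : ℕ} {f : Cn n → ℂ} (hf : Differentiable ℂ f) (i j : Fin n) (z : Cn n) :
    pdz i (fun z => z j * f z) z = (if j = i then f z else 0) + z j * pdz i f z := by
  have h : HasFDerivAt (fun z : Cn n => z j * f z) _ z :=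
    (hasFDerivAt_apply (𝕜 := ℂ) j z).mul (hf z).hasFDerivAt
  simp only [pdz, h.fderiv]
  by_cases hij : j = i
  · subst hij; simp; ring
  · simp [hij]

lemma differentiable_coord_mul {n : ℕ} {f : Cn n → ℂ} (hf : Differentiable ℂ f) (j : Fin n) :
    Differentiable ℂ fun z : Cn n => z j * f z :=
  (differentiable_apply j).mul hf

lemma dOp_dOp {n : ℕ} {u : FormC n} (hu : ∀ J, Differentiable ℂ (u J)) : dOp (dOp u) = 0 := by
  funext L z
  set g : Fin n → Fin n → ℂ := fun j i => if i ≠ j then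
    sgn j (L.erase j) * (sgn i ((L.erase j).erase i) *
      pdz j (pdz i (u ((L.erase j).erase i))) z) else 0 with hg
  have h1 : dOp (dOp u) L z = ∑ j ∈ L, ∑ i ∈ L, g j i := by
    refine Finset.sum_congr rfl fun j _ => ?_
    have h2 : pdz j (dOp u (L.erase j)) z = ∑ i ∈ L.erase j, sgn i ((L.erase j).erase i) *
        pdz j (pdz i (u ((L.erase j).erase i))) z :=
      pdz_sum_mul _ _ _ (fun i _ => differentiable_pdz (hu _) i) j z
    rw [h2, Finset.mul_sum]
    simp only [hg]
    rw [← Finset.sum_filter, Finset.filter_ne']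
  have hanti : ∀ j ∈ L, ∀ i ∈ L, g j i = -g i j := by
    intro j hj i hi
    by_cases hij : i = j
    · simp [hg, hij]
    · have hK : (L.erase i).erase j = (L.erase j).erase i := Finset.erase_right_comm
      set K := (L.erase j).erase i with hKdef
      have hLj : L.erase j = insert i K := by
        rw [hKdef, Finset.insert_erase]; simp [hi, hij]
      have hLi : L.erase i = insert j K := by
        rw [← hK, Finset.insert_erase]; simp [hj, Ne.symm hij]
      have hs := sgn_swap (K := K) hij (by simp [hKdef]) (by simp [hKdef])
      simp only [hg, if_pos hij, if_pos (Ne.symm hij), hK]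
      rw [hLi, ← hKdef, hLj, pdz_comm (hu K) i j]
      linear_combination (pdz j (pdz i (u K)) z) * hs
  have h3 : ∑ j ∈ L, ∑ i ∈ L, g j i = -∑ j ∈ L, ∑ i ∈ L, g j i := by
    conv_rhs => rw [Finset.sum_comm]
    rw [← Finset.sum_neg_distrib]
    refine Finset.sum_congr rfl fun j hj => ?_
    rw [← Finset.sum_neg_distrib]
    exact Finset.sum_congr rfl fun i hi => hanti j hj i hi
  rw [h1]
  exact self_eq_neg.mp h3

/-- Cartan's formula: `∂*∂ + ∂∂*` acts on coefficients as the Euler operator plus the degree. -/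
lemma boxOp_eq {n : ℕ} {u : FormC n} (hu : ∀ J, Differentiable ℂ (u J))
    (J : Finset (Fin n)) (z : Cn n) :
    boxOp u J z = ∑ j, z j * pdz j (u J) z + J.card * u J z := by
  have h1 : dStarOp (dOp u) J z = ∑ j ∈ Jᶜ, z j * pdz j (u J) z +
      ∑ j ∈ Jᶜ, ∑ i ∈ J, sgn j J * (z j * (sgn i ((insert j J).erase i) *
        pdz i (u ((insert j J).erase i)) z)) := by
    rw [← Finset.sum_add_distrib]
    refine Finset.sum_congr rfl fun j hj => ?_
    have hj' : j ∉ J := by simpa using hj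
    simp only [dOp]
    rw [Finset.sum_insert hj', Finset.erase_insert hj', mul_add, mul_add, Finset.mul_sum,
      Finset.mul_sum]
    congr 1
    linear_combination (z j * pdz j (u J) z) * sgn_mul_self j J
  have h2 : dOp (dStarOp u) J z = ∑ i ∈ J, (u J z + z i * pdz i (u J) z) +
      ∑ i ∈ J, ∑ j ∈ Jᶜ, sgn i (J.erase i) * (sgn j (J.erase i) *
        (z j * pdz i (u (insert j (J.erase i))) z)) := by
    rw [← Finset.sum_add_distrib]
    refine Finset.sum_congr rfl fun i hi => ?_
    have e : pdz i (dStarOp u (J.erase i)) z = ∑ j ∈ (J.erase i)ᶜ, sgn j (J.erase i) *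
        pdz i (fun z => z j * u (insert j (J.erase i)) z) z :=
      pdz_sum_mul _ _ _ (fun j _ => differentiable_coord_mul (hu _) j) i z
    have hc : (J.erase i)ᶜ = insert i Jᶜ := by
      ext k; by_cases hk : k = i <;> simp [hk]
    rw [e, hc, Finset.sum_insert (by simp [hi]), mul_add, Finset.mul_sum, Finset.insert_erase hi,
      pdz_coord_mul (hu _)]
    congr 1
    · simp only [if_true]
      linear_combination (u J z + z i * pdz i (u J) z) * sgn_mul_self i (J.erase i)
    · refine Finset.sum_congr rfl fun j hj => ?_
      have hji : j ≠ i := by rintro rfl; simp [hi] at hj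
      rw [pdz_coord_mul (hu _), if_neg hji, zero_add]
  have h3 : ∑ j ∈ Jᶜ, ∑ i ∈ J, sgn j J * (z j * (sgn i ((insert j J).erase i) *
        pdz i (u ((insert j J).erase i)) z)) =
      -∑ i ∈ J, ∑ j ∈ Jᶜ, sgn i (J.erase i) * (sgn j (J.erase i) *
        (z j * pdz i (u (insert j (J.erase i))) z)) := by
    rw [Finset.sum_comm, ← Finset.sum_neg_distrib]
    refine Finset.sum_congr rfl fun i hi => ?_
    rw [← Finset.sum_neg_distrib]
    refine Finset.sum_congr rfl fun j hj => ?_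
    have hj' : j ∉ J := by simpa using hj
    have hij : i ≠ j := by rintro rfl; exact hj' hi
    have hK : (insert j J).erase i = insert j (J.erase i) :=
      Finset.erase_insert_of_ne (Ne.symm hij)
    have hs := sgn_swap (K := J.erase i) hij (by simp) (by simp [hj'])
    rw [Finset.insert_erase hi] at hs
    rw [hK]
    have h4 := sgn_mul_self i (J.erase i)
    have h5 : sgn j J * sgn i (insert j (J.erase i)) =
        -(sgn i (J.erase i) * sgn j (J.erase i)) := by
      have h6 := sgn_mul_self i (insert j (J.erase i))
      linear_combination (sgn i (J.erase i) * sgn i (insert j (J.erase i))) * hs -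
        (sgn j J * sgn i (insert j (J.erase i))) * h4 -
        (sgn i (J.erase i) * sgn j (J.erase i)) * h6
    linear_combination (z j * pdz i (u (insert j (J.erase i))) z) * h5
  change dStarOp (dOp u) J z + dOp (dStarOp u) J z = _
  rw [h1, h2, h3, Finset.sum_add_distrib, ← Finset.sum_add_sum_compl J]
  simp only [Finset.sum_const, nsmul_eq_mul]
  ring

/-- An entire solution of `(E + c) g = 0`, `E` the Euler operator and `c ≥ 1`, vanishes. -/
lemma eq_zero_of_euler {n : ℕ} {g : Cn n → ℂ} (hg : Differentiable ℂ g) {c : ℕ} (hc : 1 ≤ c)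
    (h : ∀ z, ∑ j, z j * pdz j g z + c * g z = 0) : g = 0 := by
  funext z
  have hd : ∀ t : ℂ, HasDerivAt (fun t : ℂ => t ^ c * g (t • z)) 0 t := by
    intro t
    have h1 : HasDerivAt (fun t : ℂ => t • z) z t := by
      simpa using (hasDerivAt_id t).smul_const z
    have h2 := (hasDerivAt_pow c t).mul ((hg (t • z)).hasFDerivAt.comp_hasDerivAt t h1)
    have h3 : fderiv ℂ g (t • z) z = ∑ j, z j * pdz j g (t • z) := by
      conv_lhs => rw [sum_single_eq z, map_sum]
      simp [pdz, ← sum_single_eq z]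
    have h4 := h (t • z)
    have h5 : ∑ j, (t • z) j * pdz j g (t • z) = t * ∑ j, z j * pdz j g (t • z) := by
      rw [Finset.mul_sum]
      exact Finset.sum_congr rfl fun j _ => by simp [mul_assoc]
    rw [h5] at h4
    obtain ⟨d, rfl⟩ := Nat.exists_eq_add_of_le' hc
    refine h2.congr_deriv ?_
    rw [h3]
    simp only [Nat.add_sub_cancel, Function.comp]
    linear_combination (t ^ d) * h4
  have h6 := is_const_of_deriv_eq_zero (fun t => (hd t).differentiableAt)
    (fun t => (hd t).deriv) 1 0
  simpa [show c ≠ 0 by omega] using h6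

/-- The Gaussian weight `e^{-s|z|²}`. -/
def gaussWt {n : ℕ} (s : ℝ) (z : Cn n) : ℝ := Real.exp (-(s * ∑ j, ‖z j‖ ^ 2))

/-- Membership in the Fock space with weight `e^{-s|z|²}`. -/
def MemFock {n : ℕ} (s : ℝ) (f : Cn n → ℂ) : Prop :=
  Differentiable ℂ f ∧ Integrable (fun z : Cn n => ‖f z‖ ^ 2 * gaussWt s z)

lemma gaussWt_one {n : ℕ} (z : Cn n) : gaussWt 1 z = fWt z := by simp [gaussWt, fWt]

lemma gaussWt_nonneg {n : ℕ} (s : ℝ) (z : Cn n) : 0 ≤ gaussWt s z := (Real.exp_pos _).le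

lemma continuous_gaussWt {n : ℕ} (s : ℝ) : Continuous (gaussWt s : Cn n → ℝ) := by
  unfold gaussWt; fun_prop

lemma gaussWt_anti {n : ℕ} {s t : ℝ} (h : s ≤ t) (z : Cn n) : gaussWt t z ≤ gaussWt s z := by
  unfold gaussWt
  gcongr

lemma memF_iff_memFock {n : ℕ} {f : Cn n → ℂ} : MemF f ↔ MemFock 1 f := by
  simp [MemF, MemFock, gaussWt_one]

lemma MemFock.of_le {n : ℕ} {s : ℝ} {f g : Cn n → ℂ} (hf : MemFock s f) (t C : ℝ)
    (hg : Differentiable ℂ g)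
    (h : ∀ z, ‖g z‖ ^ 2 * gaussWt t z ≤ C * (‖f z‖ ^ 2 * gaussWt s z)) : MemFock t g := by
  refine ⟨hg, (hf.2.const_mul C).mono' ?_ (Eventually.of_forall fun z => ?_)⟩
  · exact ((hg.continuous.norm.pow 2).mul (continuous_gaussWt t)).aestronglyMeasurable
  · rw [Real.norm_of_nonneg (mul_nonneg (by positivity) (gaussWt_nonneg _ _))]
    exact h z

lemma MemFock.mono {n : ℕ} {s t : ℝ} {f : Cn n → ℂ} (hf : MemFock s f) (h : s ≤ t) :
    MemFock t f :=
  hf.of_le t 1 hf.1 fun z => by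
    rw [one_mul]
    exact mul_le_mul_of_nonneg_left (gaussWt_anti h z) (by positivity)

lemma MemFock.norm_mul_le {n : ℕ} (s : ℝ) (f g : Cn n → ℂ) (z : Cn n) :
    ‖f z * (starRingEnd ℂ) (g z) * gaussWt s z‖ ≤
      ‖f z‖ ^ 2 * gaussWt s z + ‖g z‖ ^ 2 * gaussWt s z := by
  rw [norm_mul, norm_mul, RCLike.norm_conj, norm_real, Real.norm_of_nonneg (gaussWt_nonneg _ _),
    ← add_mul]
  refine mul_le_mul_of_nonneg_right ?_ (gaussWt_nonneg _ _)
  nlinarith [sq_nonneg (‖f z‖ - ‖g z‖), norm_nonneg (f z), norm_nonneg (g z)]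

lemma aestronglyMeasurable_mul_conj {n : ℕ} (s : ℝ) {f g : Cn n → ℂ} (hf : Differentiable ℂ f)
    (hg : Differentiable ℂ g) :
    AEStronglyMeasurable (fun z : Cn n => f z * (starRingEnd ℂ) (g z) * gaussWt s z) :=
  ((hf.continuous.mul (continuous_conj.comp hg.continuous)).mul
    (continuous_ofReal.comp (continuous_gaussWt s))).aestronglyMeasurable

lemma MemFock.integrable_mul {n : ℕ} {s : ℝ} {f g : Cn n → ℂ} (hf : MemFock s f)
    (hg : MemFock s g) :
    Integrable (fun z : Cn n => f z * (starRingEnd ℂ) (g z) * gaussWt s z) :=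
  (hf.2.add hg.2).mono' (aestronglyMeasurable_mul_conj s hf.1 hg.1)
    (Eventually.of_forall (MemFock.norm_mul_le s f g))

lemma MemFock.coord_mul {n : ℕ} {s t : ℝ} {f : Cn n → ℂ} (hf : MemFock s f) (h : s < t)
    (j : Fin n) : MemFock t fun z => z j * f z := by
  refine hf.of_le t (t - s)⁻¹ (differentiable_coord_mul hf.1 j) fun z => ?_
  set S := ∑ k, ‖z k‖ ^ 2 with hS
  have h1 : ‖z j‖ ^ 2 ≤ S :=
    Finset.single_le_sum (f := fun k => ‖z k‖ ^ 2) (fun _ _ => by positivity) (Finset.mem_univ j)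
  have hts : 0 < t - s := sub_pos.2 h
  have h2 : gaussWt t z = Real.exp (-((t - s) * S)) * gaussWt s z := by
    simp only [gaussWt, ← Real.exp_add, ← hS]; congr 1; ring
  have h3 : ‖z j‖ ^ 2 * Real.exp (-((t - s) * S)) ≤ (t - s)⁻¹ := by
    rw [Real.exp_neg, ← div_eq_mul_inv, div_le_iff₀ (Real.exp_pos _), inv_mul_eq_div,
      le_div_iff₀ hts]
    have := Real.add_one_le_exp ((t - s) * S)
    nlinarith
  rw [h2, norm_mul, mul_pow]
  calc ‖z j‖ ^ 2 * ‖f z‖ ^ 2 * (Real.exp (-((t - s) * S)) * gaussWt s z)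
      = (‖z j‖ ^ 2 * Real.exp (-((t - s) * S))) * (‖f z‖ ^ 2 * gaussWt s z) := by ring
    _ ≤ _ := mul_le_mul_of_nonneg_right h3 (mul_nonneg (by positivity) (gaussWt_nonneg _ _))

/-- A translation by a unit vector changes the weight boundedly, at the cost of a larger rate. -/
lemma gaussWt_le_translate {n : ℕ} {s t : ℝ} (hs : 0 ≤ s) (h : s < t) (j : Fin n) (z : Cn n)
    {ζ : ℂ} (hζ : ‖ζ‖ = 1) :
    gaussWt t z ≤ Real.exp (s + s ^ 2 / (t - s)) * gaussWt s (z + Pi.single j ζ) := by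
  have hts : 0 < t - s := sub_pos.2 h
  obtain ⟨x, hx⟩ : ∃ x : Cn n, x = z + Pi.single j ζ := ⟨_, rfl⟩
  rw [← hx, gaussWt, gaussWt, ← Real.exp_add, Real.exp_le_exp]
  rw [← Finset.add_sum_erase univ (fun k => ‖z k‖ ^ 2) (Finset.mem_univ j),
    ← Finset.add_sum_erase univ (fun k => ‖x k‖ ^ 2)
      (Finset.mem_univ j)]
  have h1 : ∑ k ∈ univ.erase j, ‖x k‖ ^ 2 =
      ∑ k ∈ univ.erase j, ‖z k‖ ^ 2 :=
    Finset.sum_congr rfl fun k hk => by simp [hx, Finset.ne_of_mem_erase hk]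
  have h2 : 0 ≤ ∑ k ∈ univ.erase j, ‖z k‖ ^ 2 := Finset.sum_nonneg fun _ _ => by positivity
  have h3 : ‖x j‖ ≤ ‖z j‖ + 1 := by
    simpa [hx, hζ] using norm_add_le (z j) ζ
  have h4 : ‖x j‖ ^ 2 ≤ (‖z j‖ + 1) ^ 2 := by gcongr
  rw [h1]
  set A := ∑ k ∈ univ.erase j, ‖z k‖ ^ 2
  have h5 : 0 ≤ (t - s) * (‖z j‖ - s / (t - s)) ^ 2 := by positivity
  have h6 : (t - s) * (‖z j‖ - s / (t - s)) ^ 2 =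
      (t - s) * ‖z j‖ ^ 2 - 2 * s * ‖z j‖ + s ^ 2 / (t - s) := by field_simp; ring
  have h7 := mul_le_mul_of_nonneg_left h4 hs
  have h8 := mul_le_mul_of_nonneg_right h.le h2
  nlinarith

lemma norm_integral_sq_le {a b : ℝ} (hab : a < b) {φ : ℝ → ℂ} (hφ : Continuous φ) :
    ‖∫ θ in Set.Ioc a b, φ θ‖ ^ 2 ≤ (b - a) * ∫ θ in Set.Ioc a b, ‖φ θ‖ ^ 2 := by
  set A := ∫ θ in Set.Ioc a b, ‖φ θ‖ with hA
  have h1 : ‖∫ θ in Set.Ioc a b, φ θ‖ ≤ A := norm_integral_le_integral_norm _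
  have hba : 0 < b - a := sub_pos.2 hab
  have i1 : Integrable (fun θ => ‖φ θ‖ ^ 2) (volume.restrict (Set.Ioc a b)) :=
    (hφ.norm.pow 2).integrableOn_Ioc
  have i2 : Integrable (fun θ => ‖φ θ‖) (volume.restrict (Set.Ioc a b)) :=
    hφ.norm.integrableOn_Ioc
  have h2 : 0 ≤ ∫ θ in Set.Ioc a b, (‖φ θ‖ - A / (b - a)) ^ 2 :=
    integral_nonneg fun _ => sq_nonneg _
  have h3 : ∫ θ in Set.Ioc a b, (‖φ θ‖ - A / (b - a)) ^ 2 =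
      (∫ θ in Set.Ioc a b, ‖φ θ‖ ^ 2) - 2 * (A / (b - a)) * A + (b - a) * (A / (b - a)) ^ 2 := by
    have e : ∀ θ, (‖φ θ‖ - A / (b - a)) ^ 2 =
        ‖φ θ‖ ^ 2 - 2 * (A / (b - a)) * ‖φ θ‖ + (A / (b - a)) ^ 2 := fun θ => by ring
    simp_rw [e]
    rw [integral_add (f := fun θ => ‖φ θ‖ ^ 2 - 2 * (A / (b - a)) * ‖φ θ‖)
        (i1.sub (i2.const_mul _)) (integrable_const _), integral_sub i1 (i2.const_mul _),
      integral_const_mul]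
    simp [hab.le, hA]
  have h4 : A ^ 2 ≤ (b - a) * ∫ θ in Set.Ioc a b, ‖φ θ‖ ^ 2 := by
    rw [h3] at h2
    have h5 := mul_nonneg hba.le h2
    have h6 : (b - a) * ((∫ θ in Set.Ioc a b, ‖φ θ‖ ^ 2) - 2 * (A / (b - a)) * A +
      (b - a) * (A / (b - a)) ^ 2) = (b - a) * (∫ θ in Set.Ioc a b, ‖φ θ‖ ^ 2) - A ^ 2 := by
      field_simp; ring
    linarith
  exact (pow_le_pow_left₀ (norm_nonneg _) h1 2).trans h4

lemma integrable_translates {n : ℕ} {H : Cn n → ℝ} (hH : Integrable H) (hHc : Continuous H)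
    {γ : ℝ → Cn n} (hγ : Continuous γ) (a b : ℝ) :
    Integrable (fun q : Cn n × ℝ => H (q.1 + γ q.2))
      (volume.prod (volume.restrict (Set.Ioc a b))) := by
  have hcont : Continuous fun q : Cn n × ℝ => H (q.1 + γ q.2) :=
    hHc.comp (continuous_fst.add (hγ.comp continuous_snd))
  refine (integrable_prod_iff' hcont.aestronglyMeasurable).2
    ⟨Eventually.of_forall fun θ => hH.comp_add_right (γ θ), ?_⟩
  have e : ∀ θ : ℝ, ∫ z, ‖H (z + γ θ)‖ = ∫ z, ‖H z‖ := fun θ =>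
    integral_add_right_eq_self (fun z => ‖H z‖) _
  simp_rw [e]
  exact integrable_const _

lemma MemFock.pdz {n : ℕ} {s t : ℝ} {f : Cn n → ℂ} (hf : MemFock s f) (hs : 0 ≤ s) (h : s < t)
    (j : Fin n) : MemFock t (pdz j f) := by
  have hd := differentiable_pdz hf.1 j
  have hγ : Continuous fun θ : ℝ => (Pi.single j (exp (θ * I)) : Cn n) :=
    (continuous_single j).comp (by fun_prop)
  set H : Cn n → ℝ := fun z => ‖f z‖ ^ 2 * gaussWt s z with hH
  have hHc : Continuous H := (hf.1.continuous.norm.pow 2).mul (continuous_gaussWt s)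
  set C := Real.exp (s + s ^ 2 / (t - s))
  have hprod : Integrable (fun q : Cn n × ℝ => H (q.1 + Pi.single j (exp (q.2 * I))))
      (volume.prod (volume.restrict (Set.Ioc 0 (2 * Real.pi)))) :=
    integrable_translates hf.2 hHc hγ 0 (2 * Real.pi)
  refine ⟨hd, (hprod.integral_prod_left.const_mul ((2 * Real.pi)⁻¹ * C)).mono'
    ((hd.continuous.norm.pow 2).mul (continuous_gaussWt t)).aestronglyMeasurable
    (Eventually.of_forall fun z => ?_)⟩
  rw [Real.norm_of_nonneg (mul_nonneg (by positivity) (gaussWt_nonneg _ _))]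
  have hft : Continuous fun θ : ℝ => f (z + Pi.single j (exp (θ * I))) :=
    hf.1.continuous.comp (continuous_const.add hγ)
  have h1 := norm_integral_sq_le (a := 0) (b := 2 * Real.pi) (by positivity)
    (φ := fun θ : ℝ => exp (-(θ * I)) * f (z + Pi.single j (exp (θ * I))))
    (Continuous.mul (by fun_prop) hft)
  have h2 : ∀ θ : ℝ, ‖exp (-(θ * I)) * f (z + Pi.single j (exp (θ * I)))‖ ^ 2 =
      ‖f (z + Pi.single j (exp (θ * I)))‖ ^ 2 := fun θ => by simp [norm_exp]
  simp_rw [h2, sub_zero] at h1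
  have h3 : ‖_root_.pdz j f z‖ ^ 2 ≤ (2 * Real.pi)⁻¹ *
      ∫ θ in Set.Ioc 0 (2 * Real.pi), ‖f (z + Pi.single j (exp (θ * I)))‖ ^ 2 := by
    rw [pdz_eq_circle hf.1, norm_mul, mul_pow]
    have e : ‖(2 * Real.pi : ℂ)⁻¹‖ = (2 * Real.pi)⁻¹ := by
      simp [abs_of_pos Real.pi_pos]
    rw [e]
    calc _ ≤ ((2 * Real.pi)⁻¹) ^ 2 * _ := mul_le_mul_of_nonneg_left h1 (by positivity)
      _ = _ := by rw [← mul_assoc]; congr 1; field_simp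
  have h4 : (∫ θ in Set.Ioc 0 (2 * Real.pi), ‖f (z + Pi.single j (exp (θ * I)))‖ ^ 2) *
      gaussWt t z ≤ C * ∫ θ in Set.Ioc 0 (2 * Real.pi), H (z + Pi.single j (exp (θ * I))) := by
    rw [← integral_mul_const, ← integral_const_mul]
    refine integral_mono ((hft.norm.pow 2).mul continuous_const).integrableOn_Ioc
      (continuous_const.mul (hHc.comp (continuous_const.add hγ))).integrableOn_Ioc fun θ => ?_
    have h5 := gaussWt_le_translate hs h j z (norm_exp_ofReal_mul_I θ)
    calc _ ≤ ‖f (z + Pi.single j (exp (θ * I)))‖ ^ 2 * _ :=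
          mul_le_mul_of_nonneg_left h5 (by positivity)
      _ = _ := by simp only [hH]; ring
  calc _ ≤ (2 * Real.pi)⁻¹ * _ * gaussWt t z :=
        mul_le_mul_of_nonneg_right h3 (gaussWt_nonneg _ _)
    _ = (2 * Real.pi)⁻¹ * (_ * gaussWt t z) := mul_assoc _ _ _
    _ ≤ (2 * Real.pi)⁻¹ * _ := mul_le_mul_of_nonneg_left h4 (by positivity)
    _ = _ := (mul_assoc _ _ _).symm

/-- The inner product with weight `e^{-s|z|²}`. -/
def gaussInner {n : ℕ} (s : ℝ) (f g : Cn n → ℂ) : ℂ :=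
  ∫ z : Cn n, f z * (starRingEnd ℂ) (g z) * gaussWt s z

lemma tendsto_gaussInner {n : ℕ} {f g : Cn n → ℂ} (hf : MemF f) (hg : MemF g) :
    Tendsto (fun s => gaussInner s f g) (nhdsWithin 1 (Set.Ioi 1)) (nhds (fInner f g)) := by
  have hf' := memF_iff_memFock.1 hf
  have hg' := memF_iff_memFock.1 hg
  refine tendsto_integral_filter_of_dominated_convergence
    (fun z => ‖f z‖ ^ 2 * gaussWt 1 z + ‖g z‖ ^ 2 * gaussWt 1 z) ?_ ?_ (hf'.2.add hg'.2) ?_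
  · exact Eventually.of_forall fun s => aestronglyMeasurable_mul_conj s hf.1 hg.1
  · filter_upwards [self_mem_nhdsWithin] with s hs
    refine Eventually.of_forall fun z => (MemFock.norm_mul_le s f g z).trans ?_
    have := gaussWt_anti (le_of_lt hs) z
    gcongr
  · refine Eventually.of_forall fun z => ?_
    refine Tendsto.const_mul _ ?_
    rw [← gaussWt_one]
    have hc : Continuous fun s : ℝ => (gaussWt s z : ℂ) := by unfold gaussWt; fun_prop
    exact (hc.tendsto 1).mono_left nhdsWithin_le_nhds

lemma hasDerivAt_gaussWt_line {n : ℕ} (t : ℝ) (j : Fin n) (c : ℂ) (z : Cn n) :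
    HasDerivAt (fun τ : ℝ => gaussWt t (z + τ • (Pi.single j c : Cn n)))
      (gaussWt t z * -(t * (2 * ((z j).re * c.re + (z j).im * c.im)))) 0 := by
  have hsq : ∀ (k : Fin n) (τ : ℝ), ‖(z + τ • (Pi.single j c : Cn n)) k‖ ^ 2 =
      ((z k).re + τ * ((Pi.single j c : Cn n) k).re) ^ 2 +
        ((z k).im + τ * ((Pi.single j c : Cn n) k).im) ^ 2 := by
    intro k τ
    rw [Complex.sq_norm, normSq_apply]
    simp
    ring
  have hk : ∀ k : Fin n, HasDerivAt
      (fun τ : ℝ => ‖(z + τ • (Pi.single j c : Cn n)) k‖ ^ 2)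
      (2 * ((z k).re * ((Pi.single j c : Cn n) k).re +
        (z k).im * ((Pi.single j c : Cn n) k).im)) 0 := by
    intro k
    simp_rw [hsq]
    have hl : ∀ a b : ℝ, HasDerivAt (fun τ : ℝ => (a + τ * b) ^ 2) (2 * (a * b)) 0 := by
      intro a b
      have := (((hasDerivAt_id (0 : ℝ)).mul_const b).const_add a).pow 2
      refine this.congr_deriv ?_
      simp
      ring
    exact ((hl _ _).add (hl _ _)).congr_deriv (by ring)
  have hsum := HasDerivAt.fun_sum (u := univ) fun k _ => hk k
  have hval : ∑ k, 2 * ((z k).re * ((Pi.single j c : Cn n) k).re +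
      (z k).im * ((Pi.single j c : Cn n) k).im) =
      2 * ((z j).re * c.re + (z j).im * c.im) := by
    rw [Finset.sum_eq_single j]
    · simp
    · intro k _ hkj; simp [hkj]
    · simp
  rw [hval] at hsum
  have := (hsum.const_mul t).neg.exp
  refine this.congr_deriv ?_
  simp [gaussWt]

lemma hasDerivAt_line {n : ℕ} {f : Cn n → ℂ} (hf : Differentiable ℂ f) (j : Fin n) (c : ℂ)
    (z : Cn n) :
    HasDerivAt (fun τ : ℝ => f (z + τ • (Pi.single j c : Cn n))) (c * pdz j f z) 0 := by
  have h1 : HasDerivAt (fun τ : ℝ => z + τ • (Pi.single j c : Cn n)) (Pi.single j c) 0 := by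
    simpa using ((hasDerivAt_id (0 : ℝ)).smul_const (Pi.single j c : Cn n)).const_add z
  have h2 : HasFDerivAt f ((fderiv ℂ f z).restrictScalars ℝ)
      (z + (0 : ℝ) • (Pi.single j c : Cn n)) := by
    simpa using (hf z).hasFDerivAt.restrictScalars ℝ
  refine (h2.comp_hasDerivAt (0 : ℝ) h1).congr_deriv ?_
  have h3 : (Pi.single j c : Cn n) = c • Pi.single j 1 := by simp [← Pi.single_smul]
  rw [ContinuousLinearMap.coe_restrictScalars', h3, map_smul, smul_eq_mul, pdz]

lemma hasLineDerivAt_mul_conj {n : ℕ} {f g : Cn n → ℂ} (hf : Differentiable ℂ f)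
    (hg : Differentiable ℂ g) (t : ℝ) (j : Fin n) (c : ℂ) (z : Cn n) :
    HasLineDerivAt ℝ (fun z : Cn n => f z * (starRingEnd ℂ) (g z) * gaussWt t z)
      (c * (pdz j f z * (starRingEnd ℂ) (g z) * gaussWt t z) +
        (starRingEnd ℂ) c * (f z * (starRingEnd ℂ) (pdz j g z) * gaussWt t z) -
        2 * t * ((z j).re * c.re + (z j).im * c.im : ℝ) *
          (f z * (starRingEnd ℂ) (g z) * gaussWt t z)) z (Pi.single j c) := by
  have h1 := hasDerivAt_line hf j c z
  have h2 := (hasDerivAt_line hg j c z).star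
  have h3 := (hasDerivAt_gaussWt_line t j c z).ofReal_comp
  refine ((h1.mul h2).mul h3).congr_deriv ?_
  simp only [zero_smul, add_zero, Pi.mul_apply, starRingEnd_apply, star_mul', ofReal_mul,
    ofReal_neg, ofReal_ofNat]
  ring

lemma integral_eq_zero_of_hasLineDerivAt {n : ℕ} {Φ Φ' : Cn n → ℂ} {v : Cn n}
    (h : Integrable Φ) (h' : Integrable Φ') (hd : ∀ z, HasLineDerivAt ℝ Φ (Φ' z) z v) :
    ∫ z, Φ' z = 0 := by
  have := integral_bilinear_hasLineDerivAt_right_eq_neg_left_of_integrable (μ := volume)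
    (f := fun _ : Cn n => (1 : ℂ)) (f' := fun _ => 0) (g := Φ) (g' := Φ') (v := v)
    (B := ContinuousLinearMap.mul ℝ ℂ) (by simp) (by simpa using h') (by simpa using h)
    (fun x _ => by simpa [HasLineDerivAt] using hasDerivAt_const (0 : ℝ) (1 : ℂ))
    (fun x _ => hd x)
  simpa using this

/-- Multiplication by `z_j` is adjoint to `t⁻¹ ∂/∂z_j` for the weight `e^{-t|z|²}`. -/
lemma gaussInner_coord_mul {n : ℕ} {s t : ℝ} {f g : Cn n → ℂ} (hs : 0 ≤ s) (hst : s < t)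
    (hf : MemFock s f) (hg : MemFock s g) (j : Fin n) :
    t * gaussInner t (fun z => z j * f z) g = gaussInner t f (pdz j g) := by
  have hft := hf.mono hst.le
  have hgt := hg.mono hst.le
  have i0 := hft.integrable_mul hgt
  have i1 := (hf.pdz hs hst j).integrable_mul hgt
  have i2 := hft.integrable_mul (hg.pdz hs hst j)
  have i3 := (hf.coord_mul hst j).integrable_mul hgt
  have i4 := hft.integrable_mul (hg.coord_mul hst j)
  set P : Cn n → ℂ := fun z => pdz j f z * (starRingEnd ℂ) (g z) * gaussWt t z
  set Q : Cn n → ℂ := fun z => f z * (starRingEnd ℂ) (pdz j g z) * gaussWt t z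
  set R : Cn n → ℂ := fun z => z j * f z * (starRingEnd ℂ) (g z) * gaussWt t z
  set S : Cn n → ℂ := fun z => f z * (starRingEnd ℂ) (z j * g z) * gaussWt t z
  have key : ∀ c : ℂ, c * (∫ z, P z) + (starRingEnd ℂ) c * (∫ z, Q z) -
      t * ((starRingEnd ℂ) c * (∫ z, R z) + c * ∫ z, S z) = 0 := by
    intro c
    have e1 : Integrable fun z => c * P z + (starRingEnd ℂ) c * Q z :=
      (i1.const_mul _).add (i2.const_mul _)
    have e2 : Integrable fun z => (starRingEnd ℂ) c * R z + c * S z :=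
      (i3.const_mul _).add (i4.const_mul _)
    have e3 : Integrable fun z => c * P z + (starRingEnd ℂ) c * Q z -
      t * ((starRingEnd ℂ) c * R z + c * S z) := e1.sub (e2.const_mul _)
    have h := integral_eq_zero_of_hasLineDerivAt (v := Pi.single j c) i0 e3 fun z => by
      convert hasLineDerivAt_mul_conj hf.1 hg.1 t j c z using 2
      have hre : (starRingEnd ℂ) c * z j + c * (starRingEnd ℂ) (z j) =
          2 * (((z j).re * c.re + (z j).im * c.im : ℝ) : ℂ) := by
        apply Complex.ext <;> simp <;> ring
      simp only [R, S, map_mul]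
      linear_combination (t * (f z * (starRingEnd ℂ) (g z) * gaussWt t z)) * hre
    rw [integral_sub e1 (e2.const_mul _), integral_const_mul,
      integral_add (i1.const_mul _) (i2.const_mul _),
      integral_add (i3.const_mul _) (i4.const_mul _)] at h
    simpa only [integral_const_mul] using h
  have k1 := key 1
  have k2 := key I
  simp only [map_one, one_mul, conj_I] at k1 k2
  change (t : ℂ) * (∫ z, R z) = ∫ z, Q z
  linear_combination (-1 / 2) * k1 + (-I / 2) * k2 + (1 / 2 : ℂ) *
    ((∫ z, P z) - (∫ z, Q z) + t * (∫ z, R z) - t * ∫ z, S z) * I_sq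

lemma gaussInner_sum_left {n : ℕ} {ι : Type*} {s : ℝ} (S : Finset ι) (c : ι → ℂ)
    {F : ι → Cn n → ℂ} {g : Cn n → ℂ} (hF : ∀ i ∈ S, MemFock s (F i)) (hg : MemFock s g) :
    gaussInner s (fun z => ∑ i ∈ S, c i * F i z) g = ∑ i ∈ S, c i * gaussInner s (F i) g := by
  unfold gaussInner
  simp_rw [← integral_const_mul]
  rw [← integral_finsetSum S fun i hi => ((hF i hi).integrable_mul hg).const_mul (c i)]
  congr 1 with z
  rw [Finset.sum_mul, Finset.sum_mul]
  exact Finset.sum_congr rfl fun i _ => by ring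

lemma gaussInner_sum_right {n : ℕ} {ι : Type*} {s : ℝ} (S : Finset ι) (c : ι → ℂ)
    {F : ι → Cn n → ℂ} {g : Cn n → ℂ} (hF : ∀ i ∈ S, MemFock s (F i)) (hg : MemFock s g) :
    gaussInner s g (fun z => ∑ i ∈ S, c i * F i z) =
      ∑ i ∈ S, (starRingEnd ℂ) (c i) * gaussInner s g (F i) := by
  unfold gaussInner
  simp_rw [← integral_const_mul]
  rw [← integral_finsetSum S fun i hi => (hg.integrable_mul (hF i hi)).const_mul _]
  congr 1 with z
  rw [map_sum, Finset.mul_sum, Finset.sum_mul]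
  exact Finset.sum_congr rfl fun i _ => by rw [map_mul]; ring

lemma conj_sgn {n : ℕ} (j : Fin n) (J : Finset (Fin n)) : (starRingEnd ℂ) (sgn j J) = sgn j J := by
  simp [sgn]

lemma sum_compl_insert {n : ℕ} (h : Finset (Fin n) → Fin n → Finset (Fin n) → ℂ) :
    ∑ K, ∑ j ∈ Kᶜ, h (insert j K) j K = ∑ L, ∑ j ∈ L, h L j (L.erase j) := by
  rw [Finset.sum_sigma', Finset.sum_sigma']
  refine Finset.sum_bij' (fun q _ => ⟨insert q.2 q.1, q.2⟩) (fun q _ => ⟨q.1.erase q.2, q.2⟩)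
    ?_ ?_ ?_ ?_ ?_
  · simp
  · simp
  · rintro ⟨K, j⟩ hq
    have : j ∉ K := by simpa using hq
    simp [this]
  · rintro ⟨L, j⟩ hq
    have : j ∈ L := by simpa using hq
    simp [this]
  · rintro ⟨K, j⟩ hq
    have : j ∉ K := by simpa using hq
    simp [this]

lemma gaussInner_dStarOp {n : ℕ} {s : ℝ} (hs : 1 < s) {a b : FormC n} (ha : MemA2 a)
    (hb : MemA2 b) :
    s * ∑ K, gaussInner s (dStarOp a K) (b K) = ∑ L, gaussInner s (a L) (dOp b L) := by
  have ha' : ∀ J, MemFock 1 (a J) := fun J => memF_iff_memFock.1 (ha J)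
  have hb' : ∀ J, MemFock 1 (b J) := fun J => memF_iff_memFock.1 (hb J)
  have h1 : ∀ K, s * gaussInner s (dStarOp a K) (b K) =
      ∑ j ∈ Kᶜ, sgn j K * gaussInner s (a (insert j K)) (pdz j (b K)) := by
    intro K
    have e : gaussInner s (dStarOp a K) (b K) =
        ∑ j ∈ Kᶜ, sgn j K * gaussInner s (fun z => z j * a (insert j K) z) (b K) :=
      gaussInner_sum_left _ _ (fun j _ => (ha' _).coord_mul hs j) ((hb' K).mono hs.le)
    rw [e, Finset.mul_sum]
    refine Finset.sum_congr rfl fun j _ => ?_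
    rw [← gaussInner_coord_mul zero_le_one hs (ha' _) (hb' K) j]
    ring
  have h2 : ∀ L, gaussInner s (a L) (dOp b L) =
      ∑ j ∈ L, sgn j (L.erase j) * gaussInner s (a L) (pdz j (b (L.erase j))) := by
    intro L
    have e : gaussInner s (a L) (dOp b L) = ∑ j ∈ L, (starRingEnd ℂ) (sgn j (L.erase j)) *
        gaussInner s (a L) (pdz j (b (L.erase j))) :=
      gaussInner_sum_right _ _ (fun j _ => (hb' _).pdz zero_le_one hs j) ((ha' L).mono hs.le)
    simpa only [conj_sgn] using e
  rw [Finset.mul_sum]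
  simp_rw [h1, h2]
  exact sum_compl_insert fun L j K => sgn j K * gaussInner s (a L) (pdz j (b K))

/-- `∂*` and `∂` are adjoint on their maximal domains. -/
lemma formInner_dStarOp {n : ℕ} {a b : FormC n} (ha : domDs a) (hb : domD b) :
    formInner (dStarOp a) b = formInner a (dOp b) := by
  have h1 : Tendsto (fun s : ℝ => (s : ℂ) * ∑ K, gaussInner s (dStarOp a K) (b K))
      (nhdsWithin 1 (Set.Ioi 1)) (nhds (((1 : ℝ) : ℂ) * formInner (dStarOp a) b)) :=
    ((continuous_ofReal.tendsto 1).mono_left nhdsWithin_le_nhds).mul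
      (tendsto_finsetSum _ fun K _ => tendsto_gaussInner (ha.2 K) (hb.1 K))
  have h2 : Tendsto (fun s : ℝ => ∑ L, gaussInner s (a L) (dOp b L))
      (nhdsWithin 1 (Set.Ioi 1)) (nhds (formInner a (dOp b))) :=
    tendsto_finsetSum _ fun L _ => tendsto_gaussInner (ha.1 L) (hb.2 L)
  have h3 := tendsto_nhds_unique_of_eventuallyEq h1 h2 (by
    filter_upwards [self_mem_nhdsWithin] with s hs
    exact gaussInner_dStarOp hs ha.1 hb.1)
  simpa using h3

lemma gaussInner_self {n : ℕ} (s : ℝ) (f : Cn n → ℂ) :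
    gaussInner s f f = ((∫ z : Cn n, ‖f z‖ ^ 2 * gaussWt s z : ℝ) : ℂ) := by
  rw [gaussInner, ← integral_complex_ofReal]
  congr 1 with z
  rw [mul_conj, normSq_eq_norm_sq]
  push_cast
  rfl

lemma gaussInner_one {n : ℕ} (f g : Cn n → ℂ) : gaussInner 1 f g = fInner f g := by
  simp [gaussInner, fInner, gaussWt_one]

lemma fInner_self {n : ℕ} (f : Cn n → ℂ) : fInner f f = (fNormSq f : ℂ) := by
  rw [← gaussInner_one, gaussInner_self]
  simp [fNormSq, gaussWt_one]

lemma fNormSq_nonneg {n : ℕ} (f : Cn n → ℂ) : 0 ≤ fNormSq f :=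
  integral_nonneg fun _ => mul_nonneg (by positivity) (Real.exp_pos _).le

/-- The Euler operator is accretive on the Fock space. -/
lemma fInner_euler_nonneg {n : ℕ} {f : Cn n → ℂ} (hf : MemF f)
    (hE : MemF fun z : Cn n => ∑ j, z j * pdz j f z) :
    0 ≤ (fInner (fun z : Cn n => ∑ j, z j * pdz j f z) f).re := by
  have hf' := memF_iff_memFock.1 hf
  refine ge_of_tendsto ((continuous_re.tendsto _).comp (tendsto_gaussInner hE hf)) ?_
  filter_upwards [self_mem_nhdsWithin] with s (hs : 1 < s)
  have hm : 1 < (1 + s) / 2 := by linarith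
  have hms : (1 + s) / 2 < s := by linarith
  have hp : ∀ j, MemFock ((1 + s) / 2) (pdz j f) := fun j => hf'.pdz zero_le_one hm j
  have e := gaussInner_sum_left (s := s) univ (fun _ => 1)
    (fun j _ => (hp j).coord_mul hms j) (hf'.mono hs.le)
  simp only [one_mul] at e
  change 0 ≤ (gaussInner s (fun z : Cn n => ∑ j, z j * pdz j f z) f).re
  rw [e, re_sum]
  refine Finset.sum_nonneg fun j _ => ?_
  have h := gaussInner_coord_mul (by linarith) hms (hp j) (hf'.mono hm.le) j
  rw [gaussInner_self] at h
  have h2 := congrArg re h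
  rw [re_ofReal_mul, ofReal_re] at h2
  have h3 : 0 ≤ ∫ z : Cn n, ‖pdz j f z‖ ^ 2 * gaussWt s z :=
    integral_nonneg fun z => mul_nonneg (by positivity) (gaussWt_nonneg _ _)
  rw [← h2] at h3
  exact nonneg_of_mul_nonneg_right h3 (by linarith)

lemma MemF.sub_const_mul {n : ℕ} {f g : Cn n → ℂ} (hf : MemF f) (hg : MemF g) (c : ℂ) :
    MemF fun z => f z - c * g z := by
  have hd : Differentiable ℂ fun z => f z - c * g z := hf.1.sub (hg.1.const_mul c)
  rw [memF_iff_memFock] at *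
  refine ⟨hd, ((hf.2.const_mul 2).add (hg.2.const_mul (2 * ‖c‖ ^ 2))).mono'
    ((hd.continuous.norm.pow 2).mul (continuous_gaussWt 1)).aestronglyMeasurable
    (Eventually.of_forall fun z => ?_)⟩
  rw [Real.norm_of_nonneg (mul_nonneg (by positivity) (gaussWt_nonneg _ _))]
  have h1 : ‖f z - c * g z‖ ^ 2 ≤ 2 * ‖f z‖ ^ 2 + 2 * ‖c‖ ^ 2 * ‖g z‖ ^ 2 := by
    have h2 := norm_sub_le (f z) (c * g z)
    rw [norm_mul] at h2
    have h3 := pow_le_pow_left₀ (norm_nonneg _) h2 2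
    nlinarith [sq_nonneg (‖f z‖ - ‖c‖ * ‖g z‖)]
  calc _ ≤ (2 * ‖f z‖ ^ 2 + 2 * ‖c‖ ^ 2 * ‖g z‖ ^ 2) * gaussWt 1 z :=
        mul_le_mul_of_nonneg_right h1 (gaussWt_nonneg _ _)
    _ = _ := by simp only [Pi.add_apply]; ring

/-- If `(E + p) w = a` in the Fock space, `E` the Euler operator, then `p Re (w, a) ≤ ‖a‖²`. -/
lemma re_fInner_le_of_euler {n p : ℕ} {w a : Cn n → ℂ} (hw : MemF w) (ha : MemF a)
    (h : ∀ z, ∑ j, z j * pdz j w z + p * w z = a z) :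
    p * (fInner w a).re ≤ fNormSq a := by
  set e : Cn n → ℂ := fun z : Cn n => ∑ j, z j * pdz j w z with he
  have hea : e = fun z => a z - p * w z := funext fun z => by
    rw [← h z]; simp [he]
  have heF : MemF e := hea ▸ ha.sub_const_mul hw p
  have h1 := fInner_euler_nonneg hw heF
  have e' := memF_iff_memFock.1 heF
  have w' := memF_iff_memFock.1 hw
  have a' := memF_iff_memFock.1 ha
  have hF : ∀ i ∈ (univ : Finset (Fin 2)), MemFock 1 (![e, w] i) := by
    intro i _; fin_cases i <;> assumption
  have hsum : (fun z => ∑ i : Fin 2, ![(1 : ℂ), p] i * ![e, w] i z) = a := by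
    funext z
    simp [Fin.sum_univ_two, ← h z, he]
  have h2 := gaussInner_sum_left univ ![(1 : ℂ), p] hF a'
  have h3 := gaussInner_sum_right univ ![(1 : ℂ), p] hF e'
  rw [hsum] at h2 h3
  simp only [Fin.sum_univ_two, gaussInner_one, fInner_self, Matrix.cons_val_zero,
    Matrix.cons_val_one, one_mul, map_one, map_natCast] at h2 h3
  have h4 := congrArg re h2
  have h5 := congrArg re h3
  have hre : ∀ x : ℂ, ((p : ℂ) * x).re = p * x.re := fun x => by simp
  simp only [add_re, ofReal_re, hre] at h4 h5
  have h6 := fNormSq_nonneg e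
  have h7 : 0 ≤ (p : ℝ) * (fInner e w).re := mul_nonneg (Nat.cast_nonneg p) h1
  linarith

lemma formInner_self_re {n : ℕ} (u : FormC n) : (formInner u u).re = formNormSq u := by
  simp [formInner, formNormSq, fInner_self]

/-- If `∂(□̃ w) = 0` then `∂w = 0`. -/
lemma dOp_eq_zero_of_dOp_boxOp_eq_zero {n : ℕ} {w : FormC n} (hw : domBox w)
    (hbox : ∀ J, Differentiable ℂ (boxOp w J)) (h : dOp (boxOp w) = 0) : dOp w = 0 := by
  obtain ⟨hD, hDs, hDsD, hDDs⟩ := hw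
  have hvd : ∀ J, Differentiable ℂ (dOp w J) := fun J => (hD.2 J).1
  have hdd : dOp (dOp w) = 0 := dOp_dOp fun J => (hD.1 J).1
  have hdds : dOp (dOp (dStarOp w)) = 0 := dOp_dOp fun J => (hDs.2 J).1
  have h1 : ∀ J, dStarOp (dOp w) J = fun z => boxOp w J z - dOp (dStarOp w) J z := fun J =>
    funext fun z => by simp [boxOp]
  have h2 : dOp (dStarOp (dOp w)) = 0 := by
    funext L z
    have e : dOp (dStarOp (dOp w)) L z = dOp (boxOp w) L z - dOp (dOp (dStarOp w)) L z := by
      simp only [dOp, ← Finset.sum_sub_distrib]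
      refine Finset.sum_congr rfl fun j _ => ?_
      rw [h1, pdz_sub (hbox _) (hDDs.2 _).1, mul_sub]
    rw [e, h, hdds]; simp
  have h3 : boxOp (dOp w) = 0 := by
    funext J z
    simp [boxOp, hdd, h2, dStarOp]
  funext J
  rcases J.eq_empty_or_nonempty with rfl | hJ
  · funext z; simp [dOp]
  · refine eq_zero_of_euler (hvd J) hJ.card_pos fun z => ?_
    rw [← boxOp_eq hvd, h3]; rfl

/-- Canonical solution of `∂u = α`: for `α ∈ A²_{(p,0)}` with `∂α = 0`,
`u₀ = ∂* Ñ_p α` satisfies `∂u₀ = α`, `u₀ ⊥ ker ∂` (equivalently `u₀ ∈ im ∂*`),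
and `‖∂* Ñ_p α‖ ≤ p^{-1/2} ‖α‖`. -/
theorem stmt14 {n p : ℕ} (hp : 1 ≤ p) (hpn : p ≤ n - 1)
    (N : FormC n → FormC n) (hN : IsInvBox p N)
    (α : FormC n) (hdeg : IsDeg p α) (hα : MemA2 α) (hclosed : dOp α = 0) :
    dOp (dStarOp (N α)) = α ∧
    (∀ h : FormC n, IsDeg (p - 1) h → MemA2 h → dOp h = 0 →
      formInner (dStarOp (N α)) h = 0) ∧
    (∃ w : FormC n, IsDeg p w ∧ domDs w ∧ dStarOp w = dStarOp (N α)) ∧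
    Real.sqrt (formNormSq (dStarOp (N α)))
      ≤ (Real.sqrt p)⁻¹ * Real.sqrt (formNormSq α) := by
  obtain ⟨⟨hwdeg, hwdom, hbox⟩, -⟩ := hN α hdeg hα
  set w := N α
  have hdw : dOp w = 0 := dOp_eq_zero_of_dOp_boxOp_eq_zero hwdom
    (fun J => by rw [hbox]; exact (hα J).1) (by rw [hbox]; exact hclosed)
  have hsol : dOp (dStarOp w) = α := by
    rw [← hbox]
    funext J z
    simp [boxOp, hdw, dStarOp]
  refine ⟨hsol, fun h _ hh hdh => ?_, ⟨w, hwdeg, hwdom.2.1, rfl⟩, ?_⟩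
  · have hdom : domD h := ⟨hh, by
      rw [hdh]
      exact fun J => ⟨differentiable_const 0, by simp⟩⟩
    rw [formInner_dStarOp hwdom.2.1 hdom, hdh]
    simp [formInner, fInner]
  · have hnorm : formNormSq (dStarOp w) = (formInner w α).re := by
      rw [← formInner_self_re, formInner_dStarOp hwdom.2.1 hwdom.2.2.2, hsol]
    have hle : p * formNormSq (dStarOp w) ≤ formNormSq α := by
      rw [hnorm, formInner, re_sum, Finset.mul_sum, formNormSq]
      refine Finset.sum_le_sum fun J _ => ?_
      refine re_fInner_le_of_euler (hwdom.1.1 J) (hα J) fun z => ?_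
      have e := boxOp_eq (fun J => (hwdom.1.1 J).1) J z
      rw [hbox] at e
      rw [e]
      by_cases hJ : J.card = p
      · rw [hJ]
      · simp [hwdeg J hJ]
    have hp0 : (0 : ℝ) < p := by exact_mod_cast hp
    rw [inv_mul_eq_div, ← Real.sqrt_div' _ hp0.le]
    refine Real.sqrt_le_sqrt ?_
    rw [le_div_iff₀ hp0]
    linarith
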